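/- arXiv:1312.7405 — 3 statements merged into one kernel-verified Lean document; each statement's English description precedes it below -/
import Mathlib

section
/- For every n \geq 3, the sun S_n is distance antimagic; that is, there exists a bijection f : V(S_n) \to {1, ..., 2n} for which the vertex-weights w(x) = \sum_{y \in N(x)} f(y) are pairwise distinct. -/
/-- The vertex-weight of `x` under a labeling `f`: the sum of the labels of the
neighbors of `x`. -/
noncomputable def wt {α : Type*} [Fintype α] (G : SimpleGraph α) (f : α → ℕ) (x : α) : ℕ :=
  ∑ y, (G.neighborSet x).indicator f y

/-- A graph is distance antimagic if there is a bijection from the vertices onto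
`{1, …, v}` (encoded via an equivalence with `Fin v`, the label of `y` being
`f y + 1`) such that all vertex-weights are pairwise distinct. -/
def DistanceAntimagic {α : Type*} [Fintype α] (G : SimpleGraph α) : Prop :=
  ∃ f : α ≃ Fin (Fintype.card α),
    Function.Injective fun x => wt G (fun y => (f y : ℕ) + 1) x

/-- The sun `Sₙ`: a cycle on vertices `Sum.inl 0, …, Sum.inl (n-1)` together with a
pendant vertex `Sum.inr i` attached to `Sum.inl i` for each `i`. -/
def sunGraph (n : ℕ) : SimpleGraph (Fin n ⊕ Fin n) :=
  SimpleGraph.fromRel fun x y =>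
    match x, y with
    | Sum.inl x, Sum.inl y => ((x : ℕ) + 1) % n = (y : ℕ)
    | Sum.inl x, Sum.inr y => x = y
    | _, _ => False

theorem sunGraph_adj_inl_inr {n : ℕ} (i j : Fin n) :
    (sunGraph n).Adj (Sum.inl i) (Sum.inr j) ↔ j = i := by
  simp [sunGraph, eq_comm]

theorem sunGraph_adj_inr_inl {n : ℕ} (i j : Fin n) :
    (sunGraph n).Adj (Sum.inr i) (Sum.inl j) ↔ j = i := by
  simp [sunGraph]

theorem sunGraph_not_adj_inr_inr {n : ℕ} (i j : Fin n) :
    ¬ (sunGraph n).Adj (Sum.inr i) (Sum.inr j) := by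
  simp [sunGraph]

/-- The weight of a pendant vertex is the label of its neighbor on the cycle. -/
theorem wt_sunGraph_inr {n : ℕ} (f : Fin n ⊕ Fin n → ℕ) (i : Fin n) :
    wt (sunGraph n) f (Sum.inr i) = f (Sum.inl i) := by
  classical
  simp [wt, Set.indicator_apply, Fintype.sum_sum_type, sunGraph_adj_inr_inl,
    sunGraph_not_adj_inr_inr]

/-- The weight of a cycle vertex is the sum over its neighbors on the cycle plus the label of its
pendant vertex. -/
theorem wt_sunGraph_inl {n : ℕ} (f : Fin n ⊕ Fin n → ℕ) (i : Fin n) :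
    wt (sunGraph n) f (Sum.inl i) =
      ∑ j, ((sunGraph n).neighborSet (Sum.inl i)).indicator f (Sum.inl j) + f (Sum.inr i) := by
  classical
  simp [wt, Set.indicator_apply, Fintype.sum_sum_type, sunGraph_adj_inl_inr]

/-- Every function to `ℕ` on `Fin n` becomes injective after adding the values of a suitable
permutation. -/
theorem exists_perm_injective_add {n : ℕ} (s : Fin n → ℕ) :
    ∃ σ : Equiv.Perm (Fin n), Function.Injective fun i => s i + (σ i : ℕ) := by
  refine ⟨(Tuple.sort s).symm, ?_⟩
  have h : StrictMono fun k => s (Tuple.sort s k) + (k : ℕ) := fun a b hab =>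
    add_lt_add_of_le_of_lt (Tuple.monotone_sort s hab.le) hab
  intro i j hij
  apply (Tuple.sort s).symm.injective
  apply h.injective
  simpa using hij

/-- Every sun `Sₙ` (`n ≥ 3`) is distance antimagic. -/
theorem sun_distanceAntimagic (n : ℕ) (hn : 3 ≤ n) :
    DistanceAntimagic (sunGraph n) := by
  classical
  obtain ⟨σ, hσ⟩ := exists_perm_injective_add fun i : Fin n =>
    ∑ j : Fin n, if (sunGraph n).Adj (Sum.inl i) (Sum.inl j) then (j : ℕ) + 1 else 0
  refine ⟨((Equiv.sumCongr (Equiv.refl _) σ).trans finSumFinEquiv).trans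
    (finCongr (by simp)), ?_⟩
  rintro (i | i) (j | j) h <;>
    simp only [wt_sunGraph_inl, wt_sunGraph_inr, Set.indicator_apply, SimpleGraph.mem_neighborSet,
      Equiv.trans_apply, Equiv.sumCongr_apply, Sum.map_inl, Sum.map_inr, Equiv.refl_apply,
      finSumFinEquiv_apply_left, finSumFinEquiv_apply_right, finCongr_apply, Fin.val_cast,
      Fin.val_castAdd, Fin.val_natAdd] at h
  · exact congrArg Sum.inl (hσ (by dsimp only; omega))
  · omega
  · omega
  · exact congrArg Sum.inr (Fin.ext (by omega))
end

section
/- For every n \geq 3 with n \neq 4, the wheel W_n (which has order n+1) is distance antimagic; and W_4 (the wheel of order 5) is not distance antimagic. -/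
/-- The wheel `Wₙ`: a cycle on vertices `some 0, …, some (n-1)` together with a
center vertex `none` adjacent to all of them. -/
def wheelGraph (n : ℕ) : SimpleGraph (Option (Fin n)) :=
  SimpleGraph.fromRel fun x y =>
    match x, y with
    | none, some _ => True
    | some x, some y => ((x : ℕ) + 1) % n = (y : ℕ)
    | _, _ => False

/-- The zigzag labeling `0, 1, 3, 5, …, 4, 2` of the cycle of length `m`. -/
def zigzag (m j : ℕ) : ℕ :=
  if j = 0 then 0 else if 2 * j ≤ m then 2 * j - 1 else 2 * (m - j)

/-- A labeling of the rim of the wheel: the zigzag along the single distance-two cycle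
when `n` is odd, and along each of the two distance-two cycles when `n` is even. -/
def rimLabel (n i : ℕ) : ℕ :=
  if n % 2 = 1 then
    if i % 2 = 0 then zigzag n (i / 2) else zigzag n ((i + n) / 2)
  else
    if i % 2 = 0 then zigzag (n / 2) (i / 2) else n / 2 + zigzag (n / 2) (i / 2)

theorem zigzag_lt {m j : ℕ} (hj : j < m) : zigzag m j < m := by
  unfold zigzag; split_ifs <;> omega

theorem zigzag_inj {m j k : ℕ} (hj : j < m) (hk : k < m) (h : zigzag m j = zigzag m k) :
    j = k := by
  unfold zigzag at h; split_ifs at h <;> omega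

/-- `k` is the cyclic successor of `j` in `{0, …, m - 1}`. -/
def IsCyclicSucc (m j k : ℕ) : Prop :=
  j < m ∧ k < m ∧ (k = j + 1 ∨ j + 1 = m ∧ k = 0)

theorem zigzag_add_inj {m j k j' k' : ℕ} (hm : 3 ≤ m) (h : IsCyclicSucc m j k)
    (h' : IsCyclicSucc m j' k')
    (e : zigzag m j + zigzag m k = zigzag m j' + zigzag m k') : j = j' := by
  obtain ⟨h1, h2, h3⟩ := h
  obtain ⟨h1', h2', h3'⟩ := h'
  unfold zigzag at e
  split_ifs at e <;> omega

theorem zigzag_add_lt {m j k : ℕ} (h : IsCyclicSucc m j k) :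
    zigzag m j + zigzag m k < 2 * m := by
  have := zigzag_lt h.1
  have := zigzag_lt h.2.1
  omega

theorem rimLabel_lt {n i : ℕ} (hi : i < n) : rimLabel n i < n := by
  unfold rimLabel
  split_ifs
  · exact zigzag_lt (by omega)
  · exact zigzag_lt (by omega)
  · have := zigzag_lt (m := n / 2) (j := i / 2) (by omega)
    omega
  · have := zigzag_lt (m := n / 2) (j := i / 2) (by omega)
    omega

theorem rimLabel_inj {n i j : ℕ} (hi : i < n) (hj : j < n)
    (h : rimLabel n i = rimLabel n j) : i = j := by
  unfold rimLabel at h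
  by_cases hn : n % 2 = 1
  · simp only [hn, if_true] at h
    split_ifs at h <;> have := zigzag_inj (by omega) (by omega) h <;> omega
  · simp only [hn, if_false] at h
    have h1 := zigzag_lt (m := n / 2) (j := i / 2) (by omega)
    have h2 := zigzag_lt (m := n / 2) (j := j / 2) (by omega)
    have h3 := zigzag_inj (m := n / 2) (j := i / 2) (k := j / 2) (by omega) (by omega)
    split_ifs at h <;> omega

/-- Along a path `p, i, s` of the rim of odd length, the outer labels form a zigzag edge. -/
theorem exists_zigzag_of_odd {n p i s : ℕ} (hn : n % 2 = 1)
    (hp : IsCyclicSucc n p i) (hs : IsCyclicSucc n i s) :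
    ∃ j k, IsCyclicSucc n j k ∧ (2 * j + 1 = i ∨ 2 * j + 1 = i + n) ∧
      rimLabel n p + rimLabel n s = zigzag n j + zigzag n k := by
  obtain ⟨h1, h2, h3⟩ := hp
  obtain ⟨h4, h5, h6⟩ := hs
  refine ⟨if p % 2 = 0 then p / 2 else (p + n) / 2,
    if s % 2 = 0 then s / 2 else (s + n) / 2, ⟨?_, ?_, ?_⟩, ?_, ?_⟩
  · split_ifs <;> omega
  · split_ifs <;> omega
  · split_ifs <;> omega
  · split_ifs <;> omega
  · simp only [rimLabel, hn, if_true]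
    split_ifs <;> rfl

theorem exists_zigzag_of_even {n p i s : ℕ} (hn : n % 2 ≠ 1)
    (hp : IsCyclicSucc n p i) (hs : IsCyclicSucc n i s) :
    ∃ j k, IsCyclicSucc (n / 2) j k ∧ p = 2 * j + p % 2 ∧ p % 2 + i % 2 = 1 ∧
      rimLabel n p + rimLabel n s =
        zigzag (n / 2) j + zigzag (n / 2) k + n * (p % 2) := by
  obtain ⟨h1, h2, h3⟩ := hp
  obtain ⟨h4, h5, h6⟩ := hs
  refine ⟨p / 2, s / 2, ⟨?_, ?_, ?_⟩, ?_, ?_, ?_⟩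
  · omega
  · omega
  · omega
  · omega
  · omega
  · have hps : s % 2 = p % 2 := by omega
    simp only [rimLabel, hn, if_false, hps]
    rcases Nat.mod_two_eq_zero_or_one p with h | h <;> simp [h]; omega

theorem rimLabel_add_inj {n p i s p' i' s' : ℕ} (hn : 3 ≤ n) (hn4 : n ≠ 4)
    (hp : IsCyclicSucc n p i) (hs : IsCyclicSucc n i s)
    (hp' : IsCyclicSucc n p' i') (hs' : IsCyclicSucc n i' s')
    (e : rimLabel n p + rimLabel n s = rimLabel n p' + rimLabel n s') : i = i' := by
  by_cases hodd : n % 2 = 1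
  · obtain ⟨j, k, hjk, hi, h⟩ := exists_zigzag_of_odd hodd hp hs
    obtain ⟨j', k', hjk', hi', h'⟩ := exists_zigzag_of_odd hodd hp' hs'
    have := zigzag_add_inj hn hjk hjk' (by omega)
    have := hs.1
    have := hs'.1
    omega
  · obtain ⟨j, k, hjk, hj, hi, h⟩ := exists_zigzag_of_even hodd hp hs
    obtain ⟨j', k', hjk', hj', hi', h'⟩ := exists_zigzag_of_even hodd hp' hs'
    have hm : 3 ≤ n / 2 := by omega
    have b := zigzag_add_lt hjk
    have b' := zigzag_add_lt hjk'
    have hpar : p % 2 = p' % 2 := by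
      rcases Nat.mod_two_eq_zero_or_one p with q | q <;>
        rcases Nat.mod_two_eq_zero_or_one p' with q' | q' <;>
        rw [q] at h <;> rw [q'] at h' <;> omega
    rw [hpar] at h
    have := zigzag_add_inj hm hjk hjk' (by omega)
    obtain ⟨-, h2, h3⟩ := hp
    obtain ⟨-, h2', h3'⟩ := hp'
    omega

theorem wheelGraph_adj_none_some {n : ℕ} (i : Fin n) : (wheelGraph n).Adj none (some i) := by
  simp [wheelGraph]

theorem wheelGraph_adj_some_some {n : ℕ} {i j : Fin n} :
    (wheelGraph n).Adj (some i) (some j) ↔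
      i ≠ j ∧ (((i : ℕ) + 1) % n = j ∨ ((j : ℕ) + 1) % n = i) := by
  simp [wheelGraph]

theorem isCyclicSucc_iff {n : ℕ} (i j : Fin n) :
    IsCyclicSucc n i j ↔ ((i : ℕ) + 1) % n = j := by
  have hi := i.isLt
  have hj := j.isLt
  unfold IsCyclicSucc
  rcases Nat.lt_or_ge (i + 1) n with h | h
  · rw [Nat.mod_eq_of_lt h]; omega
  · have : (i : ℕ) + 1 = n := by omega
    rw [this, Nat.mod_self]; omega

theorem wt_wheelGraph_none {n : ℕ} (f : Option (Fin n) → ℕ) :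
    wt (wheelGraph n) f none = ∑ i, f (some i) := by
  simp [wt, Fintype.sum_option, Set.indicator, wheelGraph_adj_none_some]

theorem wt_wheelGraph_some {n : ℕ} (hn : 3 ≤ n) (f : Option (Fin n) → ℕ) {p i s : Fin n}
    (hp : IsCyclicSucc n p i) (hs : IsCyclicSucc n i s) :
    wt (wheelGraph n) f (some i) = f none + (f (some p) + f (some s)) := by
  have hps : p ≠ s := by
    obtain ⟨h1, h2, h3⟩ := hp
    obtain ⟨h4, h5, h6⟩ := hs
    intro h
    subst h
    omega
  have hadj (j : Fin n) : (wheelGraph n).Adj (some i) (some j) ↔ j ∈ ({p, s} : Finset (Fin n)) := by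
    rw [wheelGraph_adj_some_some, ← isCyclicSucc_iff, ← isCyclicSucc_iff, Finset.mem_insert,
      Finset.mem_singleton]
    simp only [IsCyclicSucc, ne_eq, Fin.ext_iff] at *
    omega
  rw [← Finset.sum_pair (f := fun j => f (some j)) hps]
  simp only [wt, Fintype.sum_option, Set.indicator, SimpleGraph.mem_neighborSet, hadj,
    (wheelGraph_adj_none_some i).symm, if_true]
  rw [← Finset.sum_filter]
  congr 2
  ext j
  simp

theorem exists_isCyclicSucc {n : ℕ} (i : Fin n) :
    ∃ p s : Fin n, IsCyclicSucc n p i ∧ IsCyclicSucc n i s := by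
  have hi := i.isLt
  refine ⟨⟨if (i : ℕ) = 0 then n - 1 else i - 1, by split_ifs <;> omega⟩,
    ⟨if (i : ℕ) + 1 = n then 0 else i + 1, by split_ifs <;> omega⟩, ?_, ?_⟩ <;>
  · refine ⟨?_, ?_, ?_⟩ <;> grind

/-- If the center carries the smallest label, its weight exceeds every rim weight. -/
theorem wt_some_lt_wt_none {n : ℕ} (hn : 3 ≤ n) (f : Option (Fin n) → ℕ)
    (hf : ∀ i, f none < f (some i)) (i : Fin n) :
    wt (wheelGraph n) f (some i) < wt (wheelGraph n) f none := by
  obtain ⟨p, s, hp, hs⟩ := exists_isCyclicSucc i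
  rw [wt_wheelGraph_some hn f hp hs, wt_wheelGraph_none]
  have h : ∑ j ∈ {i, p, s}, f (some j) ≤ ∑ j, f (some j) :=
    Finset.sum_le_sum_of_subset (Finset.subset_univ _)
  have hip : i ≠ p ∧ i ≠ s ∧ p ≠ s := by
    simp only [IsCyclicSucc, ne_eq, Fin.ext_iff] at *
    omega
  rw [Finset.sum_insert (by simp [hip.1, hip.2.1]), Finset.sum_pair hip.2.2] at h
  have := hf i
  omega

theorem distanceAntimagic_wheelGraph {n : ℕ} (hn : 3 ≤ n) (hn4 : n ≠ 4) :
    DistanceAntimagic (wheelGraph n) := by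
  have hcard : Fintype.card (Option (Fin n)) = n + 1 := by simp
  let g : Option (Fin n) → Fin (Fintype.card (Option (Fin n))) := fun x =>
    x.elim ⟨0, by omega⟩ fun i => ⟨rimLabel n i + 1, by have := rimLabel_lt i.isLt; omega⟩
  have hg : Function.Injective g := by
    rintro (_ | i) (_ | j) h
    · rfl
    · simp [g] at h
    · simp [g] at h
    · simp only [g, Option.elim_some, Fin.mk.injEq, Nat.add_right_cancel_iff] at h
      rw [Fin.ext (rimLabel_inj i.isLt j.isLt h)]
  refine ⟨Equiv.ofBijective g ((Fintype.bijective_iff_injective_and_card g).2 ⟨hg, by simp⟩), ?_⟩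
  simp only [Equiv.ofBijective_apply]
  have hlt := wt_some_lt_wt_none hn (fun y => (g y : ℕ) + 1) fun i => by simp [g]
  rintro (_ | i) (_ | j) h
  · rfl
  · exact absurd h (hlt j).ne'
  · exact absurd h (hlt i).ne
  · obtain ⟨p, s, hp, hs⟩ := exists_isCyclicSucc i
    obtain ⟨p', s', hp', hs'⟩ := exists_isCyclicSucc j
    dsimp only at h
    rw [wt_wheelGraph_some hn _ hp hs, wt_wheelGraph_some hn _ hp' hs'] at h
    simp only [g, Option.elim_some, Option.elim_none] at h
    rw [Fin.ext (rimLabel_add_inj hn hn4 hp hs hp' hs' (by omega))]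

/-- Every wheel `Wₙ` with `n ≥ 3` and `n ≠ 4` is distance antimagic, while the
wheel `W₄` (of order 5) is not distance antimagic. -/
theorem wheel_distanceAntimagic :
    (∀ n : ℕ, 3 ≤ n → n ≠ 4 → DistanceAntimagic (wheelGraph n)) ∧
    ¬ DistanceAntimagic (wheelGraph 4) := by
  refine ⟨fun n hn hn4 => distanceAntimagic_wheelGraph hn hn4, ?_⟩
  rintro ⟨f, hf⟩
  have twins : (wheelGraph 4).neighborSet (some 0) = (wheelGraph 4).neighborSet (some 2) := by
    ext (_ | j)
    · simp [(wheelGraph_adj_none_some _).symm]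
    · simp only [SimpleGraph.mem_neighborSet, wheelGraph_adj_some_some]
      revert j
      decide
  have h : (some 0 : Option (Fin 4)) = some 2 := hf (by simp only [wt, twins])
  simp at h
end

section
/- For every n \geq 2 with n \neq 3, the fan F_n (which has order n+1) is distance antimagic; and F_3 (the fan of order 4) is not distance antimagic. -/
/-- The fan `Fₙ`: a path on vertices `some 0, …, some (n-1)` together with a
center vertex `none` adjacent to all of them. -/
def fanGraph (n : ℕ) : SimpleGraph (Option (Fin n)) :=
  SimpleGraph.fromRel fun x y =>
    match x, y with
    | none, some _ => True
    | some x, some y => (x : ℕ) + 1 = (y : ℕ)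
    | _, _ => False

theorem wt_fanGraph_none {n : ℕ} (f : Option (Fin n) → ℕ) :
    wt (fanGraph n) f none = ∑ i : Fin n, f (some i) := by
  simp [wt, Fintype.sum_option, SimpleGraph.mem_neighborSet, fanGraph]

theorem wt_fanGraph_some {n : ℕ} (f : Option (Fin n) → ℕ) (g : ℕ → ℕ)
    (hg : ∀ i : Fin n, f (some i) = g i) (i : Fin n) :
    wt (fanGraph n) f (some i) =
      f none + ((if 0 < (i : ℕ) then g (i - 1) else 0) +
        (if (i : ℕ) + 1 < n then g (i + 1) else 0)) := by
  classical
  have hsplit : ∀ j : Fin n, ((fanGraph n).neighborSet (some i)).indicator f (some j) =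
      (if (j : ℕ) + 1 = i then g j else 0) + (if (i : ℕ) + 1 = j then g j else 0) := by
    intro j
    simp only [Set.indicator_apply, SimpleGraph.mem_neighborSet, fanGraph,
      SimpleGraph.fromRel_adj, hg, ne_eq, Option.some.injEq, Fin.ext_iff]
    split_ifs <;> omega
  have hnone : ((fanGraph n).neighborSet (some i)).indicator f none = f none := by
    simp [fanGraph]
  rw [wt, Fintype.sum_option, hnone, Finset.sum_congr rfl fun j _ => hsplit j,
    Finset.sum_add_distrib]
  congr 2
  · split_ifs with h
    · rw [Finset.sum_eq_single (⟨i - 1, by omega⟩ : Fin n)]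
      · exact if_pos (Nat.sub_add_cancel h)
      · intro j _ hj
        rw [if_neg]
        intro h'
        exact hj (Fin.ext (by simp only; omega))
      · simp
    · exact Finset.sum_eq_zero fun j _ => if_neg (by omega)
  · split_ifs with h
    · rw [Finset.sum_eq_single (⟨i + 1, h⟩ : Fin n)]
      · simp
      · intro j _ hj
        rw [if_neg]
        intro h'
        exact hj (Fin.ext (by simp only; omega))
      · simp
    · exact Finset.sum_eq_zero fun j _ => if_neg (by omega)

theorem sum_fin_add_mul_two (n k : ℕ) :
    (∑ i : Fin n, ((i : ℕ) + k)) * 2 + n = n * (n + 2 * k) := by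
  induction n with
  | zero => simp
  | succ n ih =>
    rw [Fin.sum_univ_castSucc]
    simp only [Fin.val_castSucc, Fin.val_last]
    nlinarith

/-- A labeling `x_i ↦ i + k` of the path, with label `c` at the center, has distinct weights
as soon as the path weights are distinct and differ from the weight of the center. -/
theorem fanGraph_distanceAntimagic_of_equiv {n k c : ℕ} (e : Option (Fin n) ≃ Fin (n + 1))
    (hnone : (e none : ℕ) + 1 = c) (hsome : ∀ i : Fin n, (e (some i) : ℕ) + 1 = i + k)
    (hcenter : ∀ i : Fin n, (∑ j : Fin n, ((j : ℕ) + k)) ≠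
      c + ((if 0 < (i : ℕ) then i - 1 + k else 0) + (if (i : ℕ) + 1 < n then i + 1 + k else 0)))
    (hpath : ∀ i j : ℕ, i < j → j < n →
      (if 0 < i then i - 1 + k else 0) + (if i + 1 < n then i + 1 + k else 0) ≠
      (if 0 < j then j - 1 + k else 0) + (if j + 1 < n then j + 1 + k else 0)) :
    DistanceAntimagic (fanGraph n) := by
  refine ⟨e.trans (finCongr (by simp)), ?_⟩
  have h0 : wt (fanGraph n)
      (fun y => ((e.trans (finCongr (by simp : n + 1 = Fintype.card (Option (Fin n))))) y : ℕ) + 1)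
      none = ∑ j : Fin n, ((j : ℕ) + k) := by
    rw [wt_fanGraph_none]
    exact Finset.sum_congr rfl fun i _ => by simpa using hsome i
  have h1 := wt_fanGraph_some
    (fun y => ((e.trans (finCongr (by simp : n + 1 = Fintype.card (Option (Fin n))))) y : ℕ) + 1)
    (fun m => m + k) (fun i => by simpa using hsome i)
  have hc : ((e.trans (finCongr (by simp : n + 1 = Fintype.card (Option (Fin n))))) none : ℕ) + 1
      = c := by simpa using hnone
  rw [hc] at h1
  rintro (_ | i) (_ | j) hij
  · rfl
  · exact absurd (h0.symm.trans (hij.trans (h1 j))) (hcenter j)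
  · exact absurd (h0.symm.trans (hij.symm.trans (h1 i))) (hcenter i)
  · have h := Nat.add_left_cancel ((h1 i).symm.trans (hij.trans (h1 j)))
    rcases lt_trichotomy (i : ℕ) j with hlt | heq | hlt
    · exact absurd h (hpath i j hlt j.isLt)
    · rw [Fin.ext heq]
    · exact absurd h.symm (hpath j i hlt i.isLt)

theorem fanGraph_distanceAntimagic_of_even {n : ℕ} (hn : 2 ≤ n) (he : Even n) :
    DistanceAntimagic (fanGraph n) := by
  obtain ⟨m, rfl⟩ := he
  refine fanGraph_distanceAntimagic_of_equiv (k := 1) (c := m + m + 1) finSuccEquivLast.symm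
    (by simp) (by simp) (fun i => ?_) (fun i j hij hj => ?_)
  · have hi := i.isLt
    have hs := sum_fin_add_mul_two (m + m) 1
    rcases Nat.lt_or_ge m 3 with hm | hm
    · obtain rfl | rfl : m = 1 ∨ m = 2 := by omega
      all_goals split_ifs <;> omega
    · have : 6 * (m + m) ≤ (m + m) * (m + m) := Nat.mul_le_mul_right _ (by omega)
      rw [mul_add] at hs
      split_ifs <;> omega
  · split_ifs <;> omega

theorem fanGraph_distanceAntimagic_of_odd {n : ℕ} (hn : 5 ≤ n) (ho : Odd n) :
    DistanceAntimagic (fanGraph n) := by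
  obtain ⟨m, rfl⟩ := ho
  refine fanGraph_distanceAntimagic_of_equiv (k := 2) (c := 1) (finSuccEquiv _).symm
    (by simp) (by simp) (fun i => ?_) (fun i j hij hj => ?_)
  · have hi := i.isLt
    have hs := sum_fin_add_mul_two (2 * m + 1) 2
    have : 5 * (2 * m + 1) ≤ (2 * m + 1) * (2 * m + 1) := Nat.mul_le_mul_right _ hn
    rw [mul_add] at hs
    split_ifs <;> omega
  · split_ifs <;> omega

/-- The two end vertices of the path in `F₃` have the same neighbors. -/
theorem not_distanceAntimagic_fanGraph_three : ¬ DistanceAntimagic (fanGraph 3) := by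
  rintro ⟨f, hf⟩
  have hN : (fanGraph 3).neighborSet (some 0) = (fanGraph 3).neighborSet (some 2) := by
    ext (_ | j)
    · simp [fanGraph]
    · fin_cases j <;> simp [fanGraph]
  have h : (some 0 : Option (Fin 3)) = some 2 := hf (by simp only [wt, hN])
  simp at h

/-- Every fan `Fₙ` with `n ≥ 2` and `n ≠ 3` is distance antimagic, while the fan
`F₃` (of order 4) is not distance antimagic. -/
theorem fan_distanceAntimagic :
    (∀ n : ℕ, 2 ≤ n → n ≠ 3 → DistanceAntimagic (fanGraph n)) ∧
    ¬ DistanceAntimagic (fanGraph 3) := by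
  refine ⟨fun n hn hn3 => ?_, not_distanceAntimagic_fanGraph_three⟩
  rcases Nat.even_or_odd n with he | ho
  · exact fanGraph_distanceAntimagic_of_even hn he
  · have : n % 2 = 1 := Nat.odd_iff.mp ho
    exact fanGraph_distanceAntimagic_of_odd (by omega) ho
end
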